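/- arXiv:2305.12230 — 2 statements merged into one kernel-verified Lean document; each statement's English description precedes it below -/
import Mathlib

section
/- Let α ∈ ℝ be irrational. Then for Lebesgue-almost all η ∈ [0,1) one has liminf_{k→∞} k · ‖kα − η‖ = 0, where ‖x‖ = min_{a∈ℤ} |x − a| is the distance from x to the nearest integer. -/
open MeasureTheory Filter

/-- Distance from `x` to the nearest integer: `‖x‖ = min_{a ∈ ℤ} |x - a|`. -/
noncomputable def nint (x : ℝ) : ℝ := ⨅ a : ℤ, |x - (a : ℝ)|

theorem chebyshev_freq (α : ℝ) (hα : Irrational α) (η : ℝ) (N : ℕ) :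
    ∃ k : ℕ, N ≤ k ∧ 0 < k ∧ ∃ a : ℤ, |(k : ℝ) * α - η - a| ≤ 5 / k := by
  -- rational approximation with large denominator
  obtain ⟨r, hr1, hrN⟩ : ∃ r : ℚ, |α - r| ≤ 1 / ((r.den : ℝ) ^ 2) ∧ N ≤ r.den := by
    have h1 := hα.eventually_forall_le_dist_cast_rat_of_den_le N
    have h2 : ∃ n : ℕ, 0 < n ∧ ∀ r : ℚ, r.den ≤ N → 2 / (n + 1 : ℝ) ≤ dist α r := by
      have ht : Tendsto (fun n : ℕ => 2 / (n + 1 : ℝ)) atTop (nhds 0) := by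
        have := (tendsto_one_div_add_atTop_nhds_zero_nat (𝕜 := ℝ)).const_mul 2
        simpa [div_eq_mul_inv] using this
      obtain ⟨n, hn1, hn2⟩ := ((eventually_gt_atTop 0).and (ht.eventually h1)).exists
      exact ⟨n, hn1, hn2⟩
    obtain ⟨n, hn, hn2⟩ := h2
    obtain ⟨r, hr, hrn⟩ := Real.exists_rat_abs_sub_le_and_den_le α hn
    have hd : (0 : ℝ) < r.den := by exact_mod_cast r.pos
    have hd1 : (1 : ℝ) ≤ r.den := by exact_mod_cast r.pos
    have hrn' : (r.den : ℝ) ≤ n := by exact_mod_cast hrn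
    refine ⟨r, hr.trans ?_, ?_⟩
    · apply one_div_le_one_div_of_le (by positivity)
      nlinarith
    · by_contra hlt
      have h3 := hn2 r (by omega)
      rw [Real.dist_eq] at h3
      have h4 : 1 / ((n + 1 : ℝ) * r.den) ≤ 1 / (n + 1) := by
        apply one_div_le_one_div_of_le (by positivity)
        nlinarith
      have h5 : (1 : ℝ) / (n + 1) < 2 / (n + 1) := by
        apply div_lt_div_of_pos_right (by norm_num) (by positivity)
      linarith
  have hdpos := r.pos
  have hd : (0 : ℝ) < r.den := by exact_mod_cast r.pos
  set d := r.den with hddef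
  set p := r.num with hp
  have hcop : IsCoprime p (d : ℤ) := by
    rw [Int.isCoprime_iff_gcd_eq_one]
    exact r.reduced
  obtain ⟨u, v, huv⟩ := hcop
  set m : ℤ := round ((d : ℝ) * η) with hm
  have hmle : |(d : ℝ) * η - m| ≤ 1 / 2 := abs_sub_round _
  have hk0 : 0 ≤ (m * u) % (d : ℤ) := Int.emod_nonneg _ (by omega)
  have hk1 : (m * u) % (d : ℤ) < d := Int.emod_lt_of_pos _ (by omega)
  obtain ⟨k0, hk0e⟩ := Int.eq_ofNat_of_zero_le hk0
  have hk0d : k0 < d := by omega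
  obtain ⟨a, ha⟩ : ∃ a : ℤ, ((k0 + d : ℕ) : ℤ) * p - m = d * a := by
    have h := Int.emod_add_mul_ediv (m * u) d
    refine ⟨p - (m * u / d) * p - m * v, ?_⟩
    push_cast
    have : (k0 : ℤ) = m * u - d * (m * u / d) := by
      have h' : (k0 : ℤ) = (m * u) % (d : ℤ) := hk0e.symm
      linarith
    rw [this]
    linear_combination m * huv
  have hkR : ((k0 + d : ℕ) : ℝ) ≤ 2 * d := by
    have : k0 + d ≤ 2 * d := by omega
    exact_mod_cast this
  refine ⟨k0 + d, by omega, by omega, a, ?_⟩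
  have hkpos : (0 : ℝ) < ((k0 + d : ℕ) : ℝ) := by exact_mod_cast (by omega : 0 < k0 + d)
  generalize ((k0 + d : ℕ)) = k at *
  have haR : (k : ℝ) * p - m = d * a := by exact_mod_cast ha
  have hrR : (r : ℝ) = p / d := by rw [Rat.cast_def]
  have e : (k : ℝ) * α - η - a = k * (α - r) + (-((d : ℝ) * η - m)) / d := by
    rw [hrR]
    field_simp
    linear_combination haR
  have b1 : |(k : ℝ) * (α - r)| ≤ 2 / d := by
    rw [abs_mul, abs_of_pos hkpos]
    calc (k : ℝ) * |α - r| ≤ (2 * d) * (1 / (d : ℝ) ^ 2) := by gcongr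
      _ = 2 / d := by field_simp
  have b2 : |(-((d : ℝ) * η - m)) / d| ≤ (1 / 2) / d := by
    rw [abs_div, abs_neg, abs_of_pos hd]
    gcongr
  have b3 : (2 : ℝ) / d + (1 / 2) / d ≤ 5 / k := by
    rw [← add_div, div_le_div_iff₀ hd hkpos]
    linarith
  rw [e]
  exact (abs_add_le _ _).trans ((add_le_add b1 b2).trans b3)

theorem nint_le_abs (x : ℝ) (a : ℤ) : nint x ≤ |x - a| :=
  ciInf_le ⟨0, by rintro _ ⟨b, rfl⟩; exact abs_nonneg _⟩ a

theorem nint_nonneg (x : ℝ) : 0 ≤ nint x := Real.iInf_nonneg fun _ => abs_nonneg _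

theorem freq_small (α : ℝ) (hα : Irrational α) (ε : ℝ) (hε : 0 < ε) :
    ∀ᵐ η : ℝ, ∃ᶠ k : ℕ in atTop, (k : ℝ) * nint ((k : ℝ) * α - η) ≤ ε := by
  let s : ℕ → Set ℝ := fun k => Set.range fun a : ℤ => (k : ℝ) * α - a
  have key := blimsup_cthickening_mul_ae_eq (volume : Measure ℝ) (fun _ => True) s
    (M := ε / 10) (by positivity) (fun k : ℕ => 5 / (k : ℝ))
    (tendsto_const_div_atTop_nhds_zero_nat 5)
  simp only [blimsup_true] at key
  filter_upwards [key.mem_iff] with η hη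
  have h1 := hη.2 (by
    rw [mem_limsup_iff_frequently_mem, frequently_atTop]
    intro N
    obtain ⟨k, hk, hk0, a, ha⟩ := chebyshev_freq α hα η N
    refine ⟨k, hk, Metric.mem_cthickening_of_dist_le η ((k : ℝ) * α - a) _ _ ⟨a, rfl⟩ ?_⟩
    rw [Real.dist_eq, abs_sub_comm]
    convert ha using 2
    ring)
  rw [mem_limsup_iff_frequently_mem] at h1
  refine (h1.and_eventually (eventually_gt_atTop 0)).mono ?_
  rintro k ⟨hk, hk0⟩
  have hkR : (0 : ℝ) < k := by exact_mod_cast hk0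
  have h2 := Metric.cthickening_subset_thickening' (δ₂ := ε / k) (by positivity)
    (by rw [div_mul_div_comm, div_lt_div_iff₀ (by positivity) hkR]; nlinarith [mul_pos hε hkR]) _ hk
  obtain ⟨z, ⟨a, rfl⟩, hz⟩ := Metric.mem_thickening_iff.1 h2
  rw [Real.dist_eq, abs_sub_comm] at hz
  have h3 := nint_le_abs ((k : ℝ) * α - η) a
  have h4 : nint ((k : ℝ) * α - η) ≤ ε / k := by
    refine h3.trans (le_trans (le_of_eq ?_) hz.le)
    congr 1
    ring
  calc (k : ℝ) * nint ((k : ℝ) * α - η) ≤ k * (ε / k) := by gcongr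
    _ = ε := by field_simp

/-- For every irrational `α`, for Lebesgue-almost all `η ∈ [0,1)` one has
`liminf_{k → ∞} k * ‖kα - η‖ = 0`. -/
theorem liminf_mul_nint_eq_zero_ae (α : ℝ) (hα : Irrational α) :
    ∀ᵐ η ∂(volume.restrict (Set.Ico (0 : ℝ) 1)),
      Filter.atTop.liminf (fun k : ℕ => (k : ℝ) * nint ((k : ℝ) * α - η)) = 0 := by
  apply ae_restrict_of_ae
  have h : ∀ᵐ η : ℝ, ∀ n : ℕ, ∃ᶠ k : ℕ in atTop,
      (k : ℝ) * nint ((k : ℝ) * α - η) ≤ 1 / ((n : ℝ) + 1) :=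
    ae_all_iff.2 fun n => freq_small α hα _ (by positivity)
  filter_upwards [h] with η hη
  have hnn : ∀ k : ℕ, 0 ≤ (k : ℝ) * nint ((k : ℝ) * α - η) := fun k =>
    mul_nonneg k.cast_nonneg (nint_nonneg _)
  apply le_antisymm
  · refine ge_of_tendsto' (tendsto_one_div_add_atTop_nhds_zero_nat (𝕜 := ℝ)) fun n => ?_
    exact liminf_le_of_frequently_le (hη n) (isBoundedUnder_of ⟨0, hnn⟩)
  · exact le_liminf_of_le (IsCoboundedUnder.of_frequently_le (hη 0)) (Eventually.of_forall hnn)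
end

section
/- Let n ≥ 1 and let α = (α_1, …, α_n) ∈ ℝ^n be non-singular, i.e. limsup_{t→∞} t^{1/n} · ψ_α(t) > 0, where ψ_α(t) = min_{q∈ℤ, 1≤q≤t} max_{1≤j≤n} ‖qα_j‖. Then for Lebesgue-almost all η = (η_1, …, η_n) ∈ [0,1)^n one has liminf_{k→∞} k^{1/n} · max_{1≤j≤n} ‖kα_j − η_j‖ = 0, where ‖x‖ = min_{a∈ℤ} |x − a| is the distance from x to the nearest integer. -/
open MeasureTheory Filter

/-- The irrationality measure function
`ψ_α(t) = min_{q ∈ ℤ, 1 ≤ q ≤ t} max_{1 ≤ j ≤ n} ‖q α_j‖`. -/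
noncomputable def psiFun (n : ℕ) (α : Fin n → ℝ) (t : ℝ) : ℝ :=
  sInf {v : ℝ | ∃ q : ℕ, 1 ≤ q ∧ (q : ℝ) ≤ t ∧ v = ⨆ j, nint ((q : ℝ) * α j)}

/-- `nint` is the norm on the unit circle. -/
lemma nint_eq_norm (x : ℝ) : nint x = ‖(x : UnitAddCircle)‖ := by
  rw [UnitAddCircle.norm_eq]
  apply le_antisymm
  · exact ciInf_le ⟨0, by rintro _ ⟨a, rfl⟩; positivity⟩ (round x)
  · exact le_ciInf fun a => round_le x a

lemma iSup_nint_eq_norm {n : ℕ} (hn : 1 ≤ n) (x : Fin n → ℝ) :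
    (⨆ j, nint (x j)) = ‖(fun j => (x j : UnitAddCircle) : UnitAddTorus (Fin n))‖ := by
  haveI : Nonempty (Fin n) := ⟨⟨0, hn⟩⟩
  simp_rw [nint_eq_norm]
  apply le_antisymm
  · exact ciSup_le fun j => norm_le_pi_norm (fun j => (x j : UnitAddCircle)) j
  · refine (pi_norm_le_iff_of_nonneg (Real.iSup_nonneg fun j => norm_nonneg _)).2 fun j => ?_
    exact le_ciSup (f := fun j => ‖(x j : UnitAddCircle)‖) (Set.finite_range _).bddAbove j

/-- The set of points approximated infinitely often at scale `ε k^(-1/n)`. -/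
def approxSet (n : ℕ) (a : UnitAddTorus (Fin n)) (ε : ℝ) : Set (UnitAddTorus (Fin n)) :=
  {x | ∃ᶠ k : ℕ in atTop, (k : ℝ) ^ ((1 : ℝ) / n) * ‖k • a - x‖ ≤ ε}

/-- Tail unions whose intersection is `approxSet`. -/
def tailSet (n : ℕ) (a : UnitAddTorus (Fin n)) (ε : ℝ) (M : ℕ) : Set (UnitAddTorus (Fin n)) :=
  ⋃ k : ℕ, ⋃ _ : M ≤ k, {x | (k : ℝ) ^ ((1 : ℝ) / n) * ‖k • a - x‖ ≤ ε}

lemma approxSet_eq (n : ℕ) (a : UnitAddTorus (Fin n)) (ε : ℝ) :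
    approxSet n a ε = ⋂ M, tailSet n a ε M := by
  ext x
  simp [approxSet, tailSet, frequently_atTop]

lemma measurableSet_tailSet (n : ℕ) (a : UnitAddTorus (Fin n)) (ε : ℝ) (M : ℕ) :
    MeasurableSet (tailSet n a ε M) := by
  refine MeasurableSet.iUnion fun k => MeasurableSet.iUnion fun _ => ?_
  refine (isClosed_le ?_ continuous_const).measurableSet
  fun_prop

lemma measurableSet_approxSet (n : ℕ) (a : UnitAddTorus (Fin n)) (ε : ℝ) :
    MeasurableSet (approxSet n a ε) := by
  rw [approxSet_eq]
  exact MeasurableSet.iInter fun M => measurableSet_tailSet n a ε M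

lemma volume_closedBall_torus (n : ℕ) (x : UnitAddTorus (Fin n)) (r : ℝ) (hr : 0 ≤ r)
    (hr' : 2 * r ≤ 1) : volume (Metric.closedBall x r) = ENNReal.ofReal ((2 * r) ^ n) := by
  rw [volume_pi_closedBall x hr, ENNReal.ofReal_pow (by positivity)]
  have : ∀ i, volume (Metric.closedBall (x i) r) = ENNReal.ofReal (2 * r) := by
    intro i
    have := AddCircle.volume_closedBall (T := 1) (x := x i) r
    rw [min_eq_right hr'] at this
    exact this
  simp [this]

/-- Key measure lower bound. -/
lemma tailSet_lower (n : ℕ) (hn : 1 ≤ n) (a : UnitAddTorus (Fin n)) (c ε : ℝ) (hc : 0 < c)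
    (hε : 0 < ε)
    (hsep : ∃ᶠ t : ℝ in atTop, ∀ q : ℕ, 1 ≤ q → (q : ℝ) ≤ t → c < t ^ ((1 : ℝ) / n) * ‖q • a‖)
    (hε2 : 2 * ε ≤ c) (hε3 : 2 * ε ≤ 1) (M : ℕ) :
    ENNReal.ofReal ((2 * ε) ^ n / 2) ≤ volume (tailSet n a ε M) := by
  obtain ⟨t, ht, hM⟩ := (hsep.and_eventually (eventually_ge_atTop (2 * (M : ℝ) + 2))).exists
  have hM0 : (0 : ℝ) ≤ M := by positivity
  have ht1 : 1 ≤ t := by linarith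
  have ht0 : 0 < t := by linarith
  set s : ℝ := t ^ ((1 : ℝ) / n) with hs
  have hs1 : 1 ≤ s := Real.one_le_rpow ht1 (by positivity)
  have hs0 : 0 < s := by linarith
  have hsn : s ^ n = t := by
    rw [hs, one_div]
    exact Real.rpow_inv_natCast_pow ht0.le (by omega)
  set N := ⌊t⌋₊ with hN
  have hNt : (N : ℝ) ≤ t := Nat.floor_le ht0.le
  have hNt' : t < N + 1 := Nat.lt_floor_add_one t
  have hMN : M ≤ N := by
    have : (M : ℝ) < N := by linarith
    exact_mod_cast this.le
  have hsub : (⋃ k ∈ Finset.Ioc M N, Metric.closedBall (k • a) (ε / s)) ⊆ tailSet n a ε M := by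
    intro x hx
    simp only [Set.mem_iUnion, Finset.mem_Ioc, Metric.mem_closedBall, exists_prop] at hx
    obtain ⟨k, ⟨hk1, hk2⟩, hx⟩ := hx
    simp only [tailSet, Set.mem_iUnion]
    refine ⟨k, hk1.le, ?_⟩
    rw [dist_comm, dist_eq_norm, le_div_iff₀ hs0] at hx
    have hks : (k : ℝ) ^ ((1 : ℝ) / n) ≤ s := by
      apply Real.rpow_le_rpow (by positivity) _ (by positivity)
      have : (k : ℝ) ≤ N := by exact_mod_cast hk2
      linarith
    calc (k : ℝ) ^ ((1 : ℝ) / n) * ‖k • a - x‖ ≤ s * ‖k • a - x‖ := by gcongr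
      _ ≤ ε := by linarith
  have key : ∀ k ∈ Finset.Ioc M N, ∀ l ∈ Finset.Ioc M N, k < l →
      Disjoint (Metric.closedBall (k • a) (ε / s)) (Metric.closedBall (l • a) (ε / s)) := by
    intro k hk l hl hkl
    apply Metric.closedBall_disjoint_closedBall
    rw [Finset.mem_Ioc] at hk hl
    have h1 := ht (l - k) (by omega) (by
      have : ((l - k : ℕ) : ℝ) ≤ N := by exact_mod_cast (by omega : l - k ≤ N)
      linarith)
    have h2 : (l - k) • a = l • a - k • a := by
      rw [eq_sub_iff_add_eq, ← add_nsmul, Nat.sub_add_cancel hkl.le]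
    rw [dist_comm, dist_eq_norm, ← h2, ← add_div, div_lt_iff₀ hs0]
    linarith
  have hdisj : Set.PairwiseDisjoint (↑(Finset.Ioc M N))
      (fun k : ℕ => Metric.closedBall (k • a) (ε / s)) := by
    intro k hk l hl hkl
    rcases lt_or_gt_of_ne hkl with h | h
    · exact key k hk l hl h
    · exact (key l hl k hk h).symm
  have hε' : 2 * (ε / s) ≤ 1 := by
    rw [← mul_div_assoc, div_le_one hs0]; linarith
  refine le_trans ?_ (measure_mono hsub)
  rw [measure_biUnion_finset hdisj (fun k _ => Metric.isClosed_closedBall.measurableSet)]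
  simp_rw [volume_closedBall_torus n _ (ε / s) (by positivity) hε']
  rw [Finset.sum_const, Nat.card_Ioc, nsmul_eq_mul, ← ENNReal.ofReal_natCast,
    ← ENNReal.ofReal_mul (by positivity)]
  apply ENNReal.ofReal_le_ofReal
  rw [← mul_div_assoc, div_pow, hsn, Nat.cast_sub hMN, ← mul_div_assoc, div_le_div_iff₀ two_pos ht0]
  have : 0 ≤ (2 * ε) ^ n := by positivity
  nlinarith

lemma approxSet_pos (n : ℕ) (hn : 1 ≤ n) (a : UnitAddTorus (Fin n)) (c ε : ℝ) (hc : 0 < c)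
    (hε : 0 < ε)
    (hsep : ∃ᶠ t : ℝ in atTop, ∀ q : ℕ, 1 ≤ q → (q : ℝ) ≤ t → c < t ^ ((1 : ℝ) / n) * ‖q • a‖) :
    0 < volume (approxSet n a ε) := by
  set δ := min ε (min (c / 2) (1 / 2)) with hδ
  have hδ0 : 0 < δ := by positivity
  have h1 : δ ≤ ε := min_le_left _ _
  have h2 : δ ≤ c / 2 := (min_le_right _ _).trans (min_le_left _ _)
  have h3 : δ ≤ 1 / 2 := (min_le_right _ _).trans (min_le_right _ _)
  have hsub : approxSet n a δ ⊆ approxSet n a ε := fun x hx => hx.mono fun k hk => hk.trans h1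
  refine lt_of_lt_of_le ?_ (measure_mono hsub)
  have hlim := tendsto_measure_iInter_atTop (μ := (volume : Measure (UnitAddTorus (Fin n))))
    (s := tailSet n a δ) (fun M => (measurableSet_tailSet n a δ M).nullMeasurableSet)
    (by
      intro M M' h x hx
      simp only [tailSet, Set.mem_iUnion] at hx ⊢
      obtain ⟨k, hk, hx⟩ := hx
      exact ⟨k, h.trans hk, hx⟩) ⟨0, measure_ne_top _ _⟩
  rw [← approxSet_eq] at hlim
  have := ge_of_tendsto' hlim fun M =>
    tailSet_lower n hn a c δ hc hδ0 hsep (by linarith) (by linarith) M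
  refine lt_of_lt_of_le ?_ this
  rw [ENNReal.ofReal_pos]
  positivity

lemma denseRange_zsmul (n : ℕ) (hn : 1 ≤ n) (a : UnitAddTorus (Fin n)) (c : ℝ) (hc : 0 < c)
    (hsep : ∃ᶠ t : ℝ in atTop, ∀ q : ℕ, 1 ≤ q → (q : ℝ) ≤ t → c < t ^ ((1 : ℝ) / n) * ‖q • a‖) :
    DenseRange (fun k : ℤ => k • a) := by
  have hpos := approxSet_pos n hn a c 1 hc one_pos hsep
  set H := (AddSubgroup.zmultiples a).topologicalClosure with hH
  have hHc : IsClosed (H : Set (UnitAddTorus (Fin n))) := AddSubgroup.isClosed_topologicalClosure _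
  have hsub : approxSet n a 1 ⊆ (H : Set (UnitAddTorus (Fin n))) := by
    intro x hx
    rw [hH, AddSubgroup.topologicalClosure_coe, Metric.mem_closure_iff]
    intro e he
    have hn' : (0 : ℝ) < 1 / n := by positivity
    have htend : Tendsto (fun k : ℕ => (k : ℝ) ^ ((1 : ℝ) / n)) atTop atTop :=
      (tendsto_rpow_atTop hn').comp tendsto_natCast_atTop_atTop
    obtain ⟨k, hk, hk2⟩ := (hx.and_eventually (htend.eventually_gt_atTop (1 / e))).exists
    refine ⟨k • a, AddSubgroup.nsmul_mem_zmultiples a k, ?_⟩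
    rw [dist_comm, dist_eq_norm]
    by_contra! hcon
    rw [div_lt_iff₀ he] at hk2
    have h0 : (0 : ℝ) ≤ (k : ℝ) ^ ((1 : ℝ) / n) := by positivity
    nlinarith [mul_le_mul_of_nonneg_left hcon h0]
  have hHpos : 0 < volume (H : Set (UnitAddTorus (Fin n))) := hpos.trans_le (measure_mono hsub)
  have hnhds := Measure.sub_mem_nhds_zero_of_addHaar_pos
    (volume : Measure (UnitAddTorus (Fin n))) _ hHc.measurableSet hHpos
  have hnhds' : (H : Set (UnitAddTorus (Fin n))) ∈ nhds 0 := by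
    refine Filter.mem_of_superset hnhds ?_
    rintro _ ⟨x, hx, y, hy, rfl⟩
    exact H.sub_mem hx hy
  have hopen := AddSubgroup.isOpen_of_mem_nhds H hnhds'
  have huniv : (H : Set (UnitAddTorus (Fin n))) = Set.univ :=
    IsClopen.eq_univ ⟨hHc, hopen⟩ ⟨0, H.zero_mem⟩
  rw [hH, AddSubgroup.topologicalClosure_coe] at huniv
  have := dense_iff_closure_eq.2 huniv
  rwa [AddSubgroup.coe_zmultiples] at this

lemma approxSet_ae (n : ℕ) (hn : 1 ≤ n) (a : UnitAddTorus (Fin n)) (c ε : ℝ) (hc : 0 < c)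
    (hε : 0 < ε)
    (hsep : ∃ᶠ t : ℝ in atTop, ∀ q : ℕ, 1 ≤ q → (q : ℝ) ≤ t → c < t ^ ((1 : ℝ) / n) * ‖q • a‖) :
    ∀ᵐ x : UnitAddTorus (Fin n), x ∈ approxSet n a ε := by
  have herg := ergodic_add_left_of_denseRange_zsmul (denseRange_zsmul n hn a c hc hsep)
    (volume : Measure (UnitAddTorus (Fin n)))
  have hinv : (fun x => a + x) ⁻¹' approxSet n a ε ⊆ approxSet n a ε := by
    intro x hx
    simp only [approxSet, Set.mem_preimage, Set.mem_ofPred_eq, frequently_atTop] at hx ⊢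
    intro M
    obtain ⟨k, hk, hkx⟩ := hx (M + 1)
    obtain ⟨m, rfl⟩ : ∃ m, k = m + 1 := ⟨k - 1, by omega⟩
    refine ⟨m, by omega, le_trans ?_ hkx⟩
    have h1 : (m + 1) • a - (a + x) = m • a - x := by rw [succ_nsmul]; abel
    rw [h1]
    gcongr
    simp
  rcases herg.ae_empty_or_univ_of_preimage_ae_le
    (measurableSet_approxSet n a ε).nullMeasurableSet
    (Filter.Eventually.of_forall hinv) with h | h
  · have := approxSet_pos n hn a c ε hc hε hsep
    rw [measure_congr h, measure_empty] at this
    exact absurd this (lt_irrefl _)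
  · exact eventuallyEq_univ.1 h

lemma measurePreserving_torus (n : ℕ) :
    MeasurePreserving (fun (η : Fin n → ℝ) => (fun j => (η j : UnitAddCircle) : UnitAddTorus (Fin n)))
      (volume.restrict (Set.univ.pi fun _ : Fin n => Set.Ico (0 : ℝ) 1)) volume := by
  have h := measurePreserving_pi (fun _ : Fin n => (volume : Measure ℝ).restrict (Set.Ioc 0 (0 + 1)))
    (fun _ : Fin n => (volume : Measure UnitAddCircle)) (fun i => UnitAddCircle.measurePreserving_mk 0)
  have e : (volume : Measure (Fin n → ℝ)).restrict (Set.univ.pi fun _ : Fin n => Set.Ico (0 : ℝ) 1)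
      = Measure.pi (fun _ : Fin n => (volume : Measure ℝ).restrict (Set.Ioc 0 (0 + 1))) := by
    rw [volume_pi, Measure.restrict_pi_pi, zero_add, Measure.restrict_congr_set Ico_ae_eq_Ioc]
  rw [e]
  exact h

lemma psiFun_nonneg (n : ℕ) (α : Fin n → ℝ) (t : ℝ) : 0 ≤ psiFun n α t := by
  apply Real.sInf_nonneg
  rintro v ⟨q, -, -, rfl⟩
  refine Real.iSup_nonneg fun j => ?_
  rw [nint_eq_norm]
  positivity

lemma coe_torus_nsmul (n : ℕ) (α η : Fin n → ℝ) (k : ℕ) :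
    (fun j => (((k : ℝ) * α j - η j : ℝ) : UnitAddCircle) : UnitAddTorus (Fin n)) =
      k • (fun j => (α j : UnitAddCircle)) - (fun j => (η j : UnitAddCircle)) := by
  ext j
  simp [← nsmul_eq_mul, AddCircle.coe_nsmul]

lemma sep_of_nonsingular (n : ℕ) (hn : 1 ≤ n) (α : Fin n → ℝ)
    (hns : 0 < Filter.atTop.limsup (fun t : ℝ => t ^ ((1 : ℝ) / n) * psiFun n α t)) :
    ∃ c : ℝ, 0 < c ∧ ∃ᶠ t : ℝ in atTop, ∀ q : ℕ, 1 ≤ q → (q : ℝ) ≤ t →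
      c < t ^ ((1 : ℝ) / n) * ‖q • (fun j => (α j : UnitAddCircle) : UnitAddTorus (Fin n))‖ := by
  obtain ⟨c, hc, hc'⟩ := exists_between hns
  refine ⟨c, hc, ?_⟩
  have hcob : IsCoboundedUnder (· ≤ ·) atTop
      (fun t : ℝ => t ^ ((1 : ℝ) / n) * psiFun n α t) := by
    refine IsBoundedUnder.isCoboundedUnder_le ⟨0, ?_⟩
    rw [eventually_map]
    filter_upwards [eventually_ge_atTop 0] with t ht
    exact mul_nonneg (Real.rpow_nonneg ht _) (psiFun_nonneg n α t)
  refine ((frequently_lt_of_lt_limsup hcob hc').and_eventually (eventually_ge_atTop 0)).mono ?_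
  rintro t ⟨ht, ht0⟩ q hq hqt
  refine ht.trans_le (mul_le_mul_of_nonneg_left ?_ (Real.rpow_nonneg ht0 _))
  have h1 := coe_torus_nsmul n α 0 q
  have h2 := iSup_nint_eq_norm hn (fun j => (q : ℝ) * α j - (0 : Fin n → ℝ) j)
  rw [h1] at h2
  have h3 : (fun j => (((0 : Fin n → ℝ) j : ℝ) : UnitAddCircle) : UnitAddTorus (Fin n)) = 0 := by
    ext j; simp
  rw [h3, sub_zero] at h2
  rw [← h2]
  refine csInf_le ⟨0, ?_⟩ ⟨q, hq, hqt, by simp⟩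
  rintro v ⟨q, -, -, rfl⟩
  refine Real.iSup_nonneg fun j => ?_
  rw [nint_eq_norm]
  positivity

/-- If `α ∈ ℝ^n` is non-singular, i.e. `limsup_{t→∞} t^(1/n) ψ_α(t) > 0`, then for
Lebesgue-almost all `η ∈ [0,1)^n` one has
`liminf_{k → ∞} k^(1/n) * max_j ‖kα_j - η_j‖ = 0`. -/
theorem nonsingular_liminf_zero
    (n : ℕ) (hn : 1 ≤ n) (α : Fin n → ℝ)
    (hns : 0 < Filter.atTop.limsup (fun t : ℝ => t ^ ((1 : ℝ) / n) * psiFun n α t)) :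
    ∀ᵐ η ∂(volume.restrict (Set.univ.pi fun _ : Fin n => Set.Ico (0 : ℝ) 1)),
      Filter.atTop.liminf
        (fun k : ℕ => (k : ℝ) ^ ((1 : ℝ) / n) * ⨆ j, nint ((k : ℝ) * α j - η j)) = 0 := by
  obtain ⟨c, hc, hsep⟩ := sep_of_nonsingular n hn α hns
  have hall : ∀ m : ℕ, ∀ᵐ x : UnitAddTorus (Fin n),
      x ∈ approxSet n (fun j => (α j : UnitAddCircle)) (1 / ((m : ℝ) + 1)) := fun m =>
    approxSet_ae n hn _ c _ hc (by positivity) hsep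
  have hall' := (measurePreserving_torus n).quasiMeasurePreserving.ae (ae_all_iff.2 hall)
  filter_upwards [hall'] with η hη
  have hfun : ∀ k : ℕ, (k : ℝ) ^ ((1 : ℝ) / n) * ⨆ j, nint ((k : ℝ) * α j - η j) =
      (k : ℝ) ^ ((1 : ℝ) / n) * ‖k • (fun j => (α j : UnitAddCircle) : UnitAddTorus (Fin n)) -
        (fun j => (η j : UnitAddCircle))‖ := by
    intro k
    rw [iSup_nint_eq_norm hn, coe_torus_nsmul]
  simp_rw [hfun]
  have hnonneg : ∀ k : ℕ, 0 ≤ (k : ℝ) ^ ((1 : ℝ) / n) *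
      ‖k • (fun j => (α j : UnitAddCircle) : UnitAddTorus (Fin n)) -
        (fun j => (η j : UnitAddCircle))‖ := fun k => by positivity
  have hbdd : IsBoundedUnder (· ≥ ·) atTop (fun k : ℕ => (k : ℝ) ^ ((1 : ℝ) / n) *
      ‖k • (fun j => (α j : UnitAddCircle) : UnitAddTorus (Fin n)) -
        (fun j => (η j : UnitAddCircle))‖) :=
    ⟨0, by rw [eventually_map]; exact Eventually.of_forall hnonneg⟩
  apply le_antisymm
  · refine le_of_forall_pos_le_add fun e he => ?_
    obtain ⟨m, hm⟩ := exists_nat_one_div_lt he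
    rw [zero_add]
    exact (liminf_le_of_frequently_le (hη m) hbdd).trans hm.le
  · refine le_liminf_of_le ?_ (Eventually.of_forall hnonneg)
    have hf : ∃ᶠ k : ℕ in atTop, (k : ℝ) ^ ((1 : ℝ) / n) *
      ‖k • (fun j => (α j : UnitAddCircle) : UnitAddTorus (Fin n)) -
        (fun j => (η j : UnitAddCircle))‖ ≤ 1 / (((0 : ℕ) : ℝ) + 1) := hη 0
    exact IsCobounded.of_frequently_le hf
end
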